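/- Write G = G_p(A,I). For every integer k ≥ 0, the subsets G_p^(k)(A,I) and G_p^(k+0.5)(A,I) are subgroups of G, and the following commutator relations hold between subgroups: [G, G] ≤ G_p^(0.5)(A,I); [G_p^(0.5)(A,I), G_p^(0.5)(A,I)] ≤ G_p^(2)(A,I); [G_p^(k)(A,I), G_p^(k)(A,I)] ≤ G_p^(k+2)(A,I) for every k ≥ 1; [G_p^(k)(A,I), G] ≤ G_p^(k+0.5)(A,I) for every k ≥ 0; and [G_p^(k+0.5)(A,I), G] ≤ G_p^(k+1.5)(A,I) for every k ≥ 0. -/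

import Mathlib

/-- The product of two coefficient sequences, encoding substitution of the power series
`∑_{j≥0} α_j X^(p^j)` into `∑_{i≥0} β_i X^(p^i)`:
`(α·β)_i = ∑_{j=0}^{i} (α_{i−j})^(p^j) · β_j`. -/
def seqMul {A : Type*} [CommRing A] (p : ℕ) (α β : ℕ → A) : ℕ → A :=
  fun i => ∑ j ∈ Finset.range (i + 1), α (i - j) ^ p ^ j * β j

/-- The identity sequence `δ`, with `δ_0 = 1` and `δ_i = 0` for `i ≥ 1`. -/
def seqOne {A : Type*} [CommRing A] : ℕ → A :=
  fun i => if i = 0 then 1 else 0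

/-- `I` is a square-zero ideal: `x·y = 0` for all `x, y ∈ I`. -/
def IsSqZero {A : Type*} [CommRing A] (I : Ideal A) : Prop :=
  ∀ x ∈ I, ∀ y ∈ I, x * y = 0

/-- The Steenrod group `G_p(A,I)`: sequences `α : ℕ → A` with `α 0 - 1 ∈ I`. -/
def steenrodSet {A : Type*} [CommRing A] (I : Ideal A) : Set (ℕ → A) :=
  {α | α 0 - 1 ∈ I}

/-- The filtration subgroup `G_p^(k)(A,I)`: sequences with `α_0 = 1` and `α_i = 0`
for `1 ≤ i ≤ k`. -/
def steenrodFil {A : Type*} [CommRing A] (k : ℕ) : Set (ℕ → A) :=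
  {α | α 0 = 1 ∧ ∀ i : ℕ, 1 ≤ i → i ≤ k → α i = 0}

/-- The filtration subgroup `G_p^(k+0.5)(A,I)`: elements of `G_p^(k)(A,I)` with
`α_{k+1} ∈ I`. -/
def steenrodFilHalf {A : Type*} [CommRing A] (I : Ideal A) (k : ℕ) : Set (ℕ → A) :=
  {α | α ∈ steenrodFil k ∧ α (k + 1) ∈ I}

/-- `S` is a subgroup for the product `seqMul p`: it contains the identity `δ`, is
closed under the product, and is closed under two-sided inverses. -/
def IsSeqSubgroup {A : Type*} [CommRing A] (p : ℕ) (S : Set (ℕ → A)) : Prop :=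
  seqOne ∈ S ∧
  (∀ a ∈ S, ∀ b ∈ S, seqMul p a b ∈ S) ∧
  (∀ a ∈ S, ∀ a' : ℕ → A, seqMul p a a' = seqOne → seqMul p a' a = seqOne → a' ∈ S)

/-- The set of commutators `(a⁻¹·b⁻¹)·(a·b)` with `a ∈ H` and `b ∈ K` (inverses being
two-sided inverses for the product `seqMul p`). -/
def commSet {A : Type*} [CommRing A] (p : ℕ) (H K : Set (ℕ → A)) : Set (ℕ → A) :=
  {c | ∃ a ∈ H, ∃ b ∈ K, ∃ a' b' : ℕ → A,
    seqMul p a a' = seqOne ∧ seqMul p a' a = seqOne ∧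
    seqMul p b b' = seqOne ∧ seqMul p b' b = seqOne ∧
    c = seqMul p (seqMul p a' b') (seqMul p a b)}

section SeqMul

variable {A : Type*} [CommRing A] {p : ℕ}

theorem seqMul_eq_sum_antidiagonal (p : ℕ) (α β : ℕ → A) (i : ℕ) :
    seqMul p α β i = ∑ x ∈ Finset.HasAntidiagonal.antidiagonal i, α x.1 ^ p ^ x.2 * β x.2 := by
  rw [← Finset.Nat.sum_antidiagonal_swap]
  exact (Finset.Nat.sum_antidiagonal_eq_sum_range_succ
    (fun j l => α l ^ p ^ j * β j) i).symm

theorem seqMul_assoc [Fact p.Prime] [CharP A p] (α β γ : ℕ → A) :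
    seqMul p (seqMul p α β) γ = seqMul p α (seqMul p β γ) := by
  funext i
  simp only [seqMul_eq_sum_antidiagonal, sum_pow_char_pow, Finset.sum_mul, Finset.mul_sum]
  rw [Finset.sum_sigma', Finset.sum_sigma']
  refine Finset.sum_nbij' (fun x => ⟨(x.2.1, x.2.2 + x.1.2), (x.2.2, x.1.2)⟩)
    (fun x => ⟨(x.1.1 + x.2.1, x.2.2), (x.1.1, x.2.1)⟩) ?_ ?_ ?_ ?_ ?_
  · rintro ⟨⟨a, b⟩, ⟨c, d⟩⟩ h
    simp only [Finset.mem_sigma, Finset.HasAntidiagonal.mem_antidiagonal] at h ⊢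
    exact ⟨by omega, trivial⟩
  · rintro ⟨⟨a, b⟩, ⟨c, d⟩⟩ h
    simp only [Finset.mem_sigma, Finset.HasAntidiagonal.mem_antidiagonal] at h ⊢
    exact ⟨by omega, trivial⟩
  · rintro ⟨⟨a, b⟩, ⟨c, d⟩⟩ h
    simp only [Finset.mem_sigma, Finset.HasAntidiagonal.mem_antidiagonal] at h
    simp [h.2]
  · rintro ⟨⟨a, b⟩, ⟨c, d⟩⟩ h
    simp only [Finset.mem_sigma, Finset.HasAntidiagonal.mem_antidiagonal] at h
    simp [h.2]
  · rintro ⟨⟨a, b⟩, ⟨c, d⟩⟩ -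
    simp only [mul_pow, ← pow_mul, ← pow_add, mul_assoc]

theorem seqOne_seqMul (hp : p ≠ 0) (β : ℕ → A) : seqMul p seqOne β = β := by
  funext i
  rw [seqMul, Finset.sum_eq_single i]
  · simp [seqOne]
  · intro j hj hji
    have : i - j ≠ 0 := by have := Finset.mem_range.1 hj; omega
    simp [seqOne, this, hp]
  · simp

theorem seqMul_zero (α β : ℕ → A) : seqMul p α β 0 = α 0 * β 0 := by
  simp [seqMul]

theorem seqMul_one (α β : ℕ → A) : seqMul p α β 1 = α 1 * β 0 + α 0 ^ p * β 1 := by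
  simp [seqMul, Finset.sum_range_succ]

theorem seqMul_apply_of_mem_steenrodFil {k : ℕ} {α : ℕ → A} (hα : α ∈ steenrodFil k)
    (hp : p ≠ 0) (β : ℕ → A) {i : ℕ} (hi : i ≤ k) : seqMul p α β i = β i := by
  rw [seqMul, Finset.sum_range_succ, Finset.sum_eq_zero]
  · simp [hα.1]
  · intro j hj
    have := Finset.mem_range.1 hj
    simp [hα.2 (i - j) (by omega) (by omega), hp]

theorem seqMul_apply_add_one_of_mem_steenrodFil {k : ℕ} {α : ℕ → A} (hα : α ∈ steenrodFil k)
    (hp : p ≠ 0) (β : ℕ → A) : seqMul p α β (k + 1) = α (k + 1) * β 0 + β (k + 1) := by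
  rw [seqMul, Finset.sum_range_succ, Finset.sum_range_succ', Finset.sum_eq_zero]
  · simp [hα.1]
  · intro j hj
    have := Finset.mem_range.1 hj
    simp [hα.2 (k - j) (by omega) (by omega), hp]

theorem seqMul_apply_add_two_of_mem_steenrodFil {k : ℕ} {α : ℕ → A} (hα : α ∈ steenrodFil k)
    (hp : p ≠ 0) (β : ℕ → A) :
    seqMul p α β (k + 2) = α (k + 2) * β 0 + α (k + 1) ^ p * β 1 + β (k + 2) := by
  rw [seqMul, Finset.sum_range_succ, Finset.sum_range_succ', Finset.sum_range_succ',
    Finset.sum_eq_zero]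
  · simp [hα.1]
    ring
  · intro j hj
    have := Finset.mem_range.1 hj
    have hkj : k + 2 - (j + 1 + 1) = k - j := by omega
    simp [hkj, hα.2 (k - j) (by omega) (by omega), hp]

theorem seqMul_apply_of_mem_steenrodFil_right {k : ℕ} {α : ℕ → A} (hα : α ∈ steenrodFil k)
    (β : ℕ → A) {i : ℕ} (hi : i ≤ k) : seqMul p β α i = β i := by
  rw [seqMul, Finset.sum_range_succ', Finset.sum_eq_zero]
  · simp [hα.1]
  · intro j hj
    have := Finset.mem_range.1 hj
    simp [hα.2 (j + 1) (by omega) (by omega)]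

theorem seqMul_apply_add_one_of_mem_steenrodFil_right {k : ℕ} {α : ℕ → A}
    (hα : α ∈ steenrodFil k) (β : ℕ → A) :
    seqMul p β α (k + 1) = β (k + 1) + β 0 ^ p ^ (k + 1) * α (k + 1) := by
  rw [seqMul, Finset.sum_range_succ, Finset.sum_range_succ', Finset.sum_eq_zero]
  · simp [hα.1]
  · intro j hj
    have := Finset.mem_range.1 hj
    simp [hα.2 (j + 1) (by omega) (by omega)]

theorem seqMul_apply_add_two_of_mem_steenrodFil_right {k : ℕ} {α : ℕ → A}
    (hα : α ∈ steenrodFil k) (β : ℕ → A) :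
    seqMul p β α (k + 2) = β (k + 2) + β 1 ^ p ^ (k + 1) * α (k + 1)
      + β 0 ^ p ^ (k + 2) * α (k + 2) := by
  rw [seqMul, Finset.sum_range_succ, Finset.sum_range_succ, Finset.sum_range_succ',
    Finset.sum_eq_zero]
  · simp [hα.1]
  · intro j hj
    have := Finset.mem_range.1 hj
    simp [hα.2 (j + 1) (by omega) (by omega)]

/-- If `u` and `u·c` agree up to degree `n`, then `c` lies in the `n`-th filtration step. -/
theorem mem_steenrodFil_of_seqMul_eq {n : ℕ} {u c : ℕ → A} (hu : IsUnit (u 0))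
    (h : ∀ i ≤ n, seqMul p u c i = u i) : c ∈ steenrodFil n := by
  have h0 : c 0 = 1 := by
    have := h 0 n.zero_le
    rw [seqMul_zero] at this
    exact hu.mul_left_cancel (by rw [this, mul_one])
  induction n with
  | zero => exact ⟨h0, fun i h1 h2 => by omega⟩
  | succ n ih =>
    have hc := ih fun i hi => h i (by omega)
    refine ⟨h0, fun i h1 h2 => ?_⟩
    obtain h2 | rfl := Nat.le_succ_iff.1 h2
    · exact hc.2 i h1 h2
    · have := h (n + 1) le_rfl
      rw [seqMul_apply_add_one_of_mem_steenrodFil_right hc, add_eq_left] at this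
      exact (hu.pow _).mul_right_eq_zero.1 this

theorem mem_steenrodFilHalf_of_seqMul_sub_mem {I : Ideal A} {n : ℕ} {u c : ℕ → A}
    (hu : IsUnit (u 0)) (h : ∀ i ≤ n, seqMul p u c i = u i)
    (h' : seqMul p u c (n + 1) - u (n + 1) ∈ I) : c ∈ steenrodFilHalf I n := by
  have hc := mem_steenrodFil_of_seqMul_eq hu h
  refine ⟨hc, ?_⟩
  rw [seqMul_apply_add_one_of_mem_steenrodFil_right hc, add_sub_cancel_left] at h'
  exact (Ideal.unit_mul_mem_iff_mem I (hu.pow _)).1 h'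

theorem isSeqSubgroup_steenrodFil (hp : p ≠ 0) (k : ℕ) :
    IsSeqSubgroup p (steenrodFil (A := A) k) := by
  refine ⟨⟨by simp [seqOne], fun i h _ => by simp [seqOne]; omega⟩, fun a ha b hb => ?_,
    fun a ha a' h _ => ?_⟩
  · exact ⟨by rw [seqMul_zero, ha.1, hb.1, one_mul], fun i h1 h2 => by
      rw [seqMul_apply_of_mem_steenrodFil ha hp b h2, hb.2 i h1 h2]⟩
  · refine mem_steenrodFil_of_seqMul_eq (p := p) (u := a) (by simp [ha.1]) fun i hi => ?_
    rw [h]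
    rcases i with _ | i
    · simp [seqOne, ha.1]
    · simp [seqOne, ha.2 (i + 1) (by omega) hi]

theorem isSeqSubgroup_steenrodFilHalf (hp : p ≠ 0) (I : Ideal A) (k : ℕ) :
    IsSeqSubgroup p (steenrodFilHalf I k) := by
  have hk := isSeqSubgroup_steenrodFil (A := A) hp k
  refine ⟨⟨hk.1, by simp [seqOne]⟩, fun a ha b hb => ⟨hk.2.1 a ha.1 b hb.1, ?_⟩,
    fun a ha a' h h' => ⟨hk.2.2 a ha.1 a' h h', ?_⟩⟩
  · rw [seqMul_apply_add_one_of_mem_steenrodFil ha.1 hp]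
    exact I.add_mem (I.mul_mem_right _ ha.2) hb.2
  · have ha' := hk.2.2 a ha.1 a' h h'
    have := congrFun h (k + 1)
    rw [seqMul_apply_add_one_of_mem_steenrodFil ha.1 hp, ha'.1, mul_one] at this
    simp only [seqOne, Nat.add_eq_zero_iff, one_ne_zero, and_false, if_false] at this
    rw [eq_neg_of_add_eq_zero_right this]
    exact I.neg_mem ha.2

/-- Every commutator `c` of `a` and `b` satisfies `(b·a)·c = a·b`, with `(b·a)_0` a unit. -/
theorem exists_of_mem_commSet [Fact p.Prime] [CharP A p] {H K : Set (ℕ → A)} {c : ℕ → A}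
    (hc : c ∈ commSet p H K) : ∃ a ∈ H, ∃ b ∈ K,
      IsUnit (seqMul p b a 0) ∧ seqMul p (seqMul p b a) c = seqMul p a b := by
  obtain ⟨a, ha, b, hb, a', b', h1, -, h3, -, rfl⟩ := hc
  have hp := (Fact.out : p.Prime).ne_zero
  refine ⟨a, ha, b, hb, ?_, ?_⟩
  · have hua := congrFun h1 0
    have hub := congrFun h3 0
    simp only [seqMul_zero, seqOne, if_true] at hua hub
    rw [seqMul_zero]
    exact (IsUnit.of_mul_eq_one _ hub).mul (IsUnit.of_mul_eq_one _ hua)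
  · rw [← seqMul_assoc, seqMul_assoc b a, ← seqMul_assoc a a' b', h1, seqOne_seqMul hp, h3,
      seqOne_seqMul hp]

theorem commSet_subset_steenrodFil [Fact p.Prime] [CharP A p] {H K : Set (ℕ → A)} {n : ℕ}
    (h : ∀ a ∈ H, ∀ b ∈ K, ∀ i ≤ n, seqMul p a b i = seqMul p b a i) :
    commSet p H K ⊆ steenrodFil n := by
  intro c hc
  obtain ⟨a, ha, b, hb, hu, he⟩ := exists_of_mem_commSet hc
  exact mem_steenrodFil_of_seqMul_eq hu fun i hi => by rw [he, h a ha b hb i hi]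

theorem commSet_subset_steenrodFilHalf [Fact p.Prime] [CharP A p] {H K : Set (ℕ → A)}
    {I : Ideal A} {n : ℕ}
    (h : ∀ a ∈ H, ∀ b ∈ K, ∀ i ≤ n, seqMul p a b i = seqMul p b a i)
    (h' : ∀ a ∈ H, ∀ b ∈ K, seqMul p a b (n + 1) - seqMul p b a (n + 1) ∈ I) :
    commSet p H K ⊆ steenrodFilHalf I n := by
  intro c hc
  obtain ⟨a, ha, b, hb, hu, he⟩ := exists_of_mem_commSet hc
  exact mem_steenrodFilHalf_of_seqMul_sub_mem hu (fun i hi => by rw [he, h a ha b hb i hi])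
    (by rw [he]; exact h' a ha b hb)

theorem IsSqZero.pow_eq_zero {I : Ideal A} (hI : IsSqZero I) {x : A} (hx : x ∈ I) {n : ℕ}
    (hn : 2 ≤ n) : x ^ n = 0 :=
  pow_eq_zero_of_le hn (by rw [sq, hI x hx x hx])

theorem IsSqZero.pow_char_pow_eq_one [Fact p.Prime] [CharP A p] {I : Ideal A}
    (hI : IsSqZero I) {x : A} (hx : x - 1 ∈ I) {n : ℕ} (hn : n ≠ 0) : x ^ p ^ n = 1 := by
  have hp := (Fact.out : p.Prime)
  have h := hI.pow_eq_zero hx (hp.two_le.trans (Nat.le_self_pow hn p))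
  rwa [sub_pow_char_pow, one_pow, sub_eq_zero] at h

end SeqMul

/-- Let `p` be a prime, `A` a commutative ring of characteristic `p`,
`I` a square-zero ideal of `A`, and write `G = G_p(A,I)`.  For every `k ≥ 0` the subsets
`G_p^(k)(A,I)` and `G_p^(k+0.5)(A,I)` are subgroups of `G`, and the commutator subgroup
relations `[G,G] ≤ G_p^(0.5)`, `[G_p^(0.5),G_p^(0.5)] ≤ G_p^(2)`,
`[G_p^(k),G_p^(k)] ≤ G_p^(k+2)` for `k ≥ 1`, `[G_p^(k),G] ≤ G_p^(k+0.5)` and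
`[G_p^(k+0.5),G] ≤ G_p^(k+1.5)` hold (the filtration sets being subgroups, these
relations are expressed by saying that each generating set of commutators is contained
in the corresponding filtration set). -/
theorem steenrod_filtration_commutators {A : Type*} [CommRing A] (p : ℕ) (hp : p.Prime)
    [CharP A p] (I : Ideal A) (hI : IsSqZero I) :
    (∀ k : ℕ,
        steenrodFil (A := A) k ⊆ steenrodSet I ∧ IsSeqSubgroup p (steenrodFil (A := A) k) ∧
        steenrodFilHalf I k ⊆ steenrodSet I ∧ IsSeqSubgroup p (steenrodFilHalf I k)) ∧
    commSet p (steenrodSet I) (steenrodSet I) ⊆ steenrodFilHalf I 0 ∧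
    commSet p (steenrodFilHalf I 0) (steenrodFilHalf I 0) ⊆ steenrodFil 2 ∧
    (∀ k : ℕ, 1 ≤ k →
        commSet p (steenrodFil (A := A) k) (steenrodFil k) ⊆ steenrodFil (k + 2)) ∧
    (∀ k : ℕ, commSet p (steenrodFil k) (steenrodSet I) ⊆ steenrodFilHalf I k) ∧
    (∀ k : ℕ, commSet p (steenrodFilHalf I k) (steenrodSet I) ⊆ steenrodFilHalf I (k + 1)) := by
  have := Fact.mk hp
  have hp0 := hp.ne_zero
  refine ⟨fun k => ⟨fun a ha => by simp [steenrodSet, ha.1], isSeqSubgroup_steenrodFil hp0 k,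
    fun a ha => by simp [steenrodSet, ha.1.1], isSeqSubgroup_steenrodFilHalf hp0 I k⟩,
    ?_, ?_, fun k hk => ?_, fun k => ?_, fun k => ?_⟩
  · refine commSet_subset_steenrodFilHalf (fun a _ b _ i hi => ?_) fun a ha b hb => ?_
    · obtain rfl := Nat.le_zero.1 hi
      rw [seqMul_zero, seqMul_zero, mul_comm]
    · have h1 : a 0 ^ p = 1 := by simpa using hI.pow_char_pow_eq_one (p := p) ha one_ne_zero
      have h2 : b 0 ^ p = 1 := by simpa using hI.pow_char_pow_eq_one (p := p) hb one_ne_zero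
      rw [seqMul_one, seqMul_one, h1, h2]
      have := I.sub_mem (I.mul_mem_left (a 1) hb) (I.mul_mem_left (b 1) ha)
      convert this using 1
      ring
  · refine commSet_subset_steenrodFil fun a ha b hb i hi => ?_
    obtain rfl | rfl | rfl : i = 0 ∨ i = 0 + 1 ∨ i = 0 + 2 := by omega
    · rw [seqMul_zero, seqMul_zero, mul_comm]
    · rw [seqMul_apply_add_one_of_mem_steenrodFil ha.1 hp0,
        seqMul_apply_add_one_of_mem_steenrodFil hb.1 hp0, ha.1.1, hb.1.1]
      ring
    · rw [seqMul_apply_add_two_of_mem_steenrodFil ha.1 hp0,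
        seqMul_apply_add_two_of_mem_steenrodFil hb.1 hp0, ha.1.1, hb.1.1,
        hI.pow_eq_zero ha.2 hp.two_le, hI.pow_eq_zero hb.2 hp.two_le]
      ring
  · refine commSet_subset_steenrodFil fun a ha b hb i hi => ?_
    obtain hi | rfl | rfl : i ≤ k ∨ i = k + 1 ∨ i = k + 2 := by omega
    · rw [seqMul_apply_of_mem_steenrodFil ha hp0 b hi,
        seqMul_apply_of_mem_steenrodFil_right ha b hi]
    · rw [seqMul_apply_add_one_of_mem_steenrodFil ha hp0,
        seqMul_apply_add_one_of_mem_steenrodFil hb hp0, ha.1, hb.1]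
      ring
    · rw [seqMul_apply_add_two_of_mem_steenrodFil ha hp0,
        seqMul_apply_add_two_of_mem_steenrodFil hb hp0, ha.1, hb.1,
        ha.2 1 le_rfl hk, hb.2 1 le_rfl hk]
      ring
  · refine commSet_subset_steenrodFilHalf (fun a ha b _ i hi => ?_) fun a ha b hb => ?_
    · rw [seqMul_apply_of_mem_steenrodFil ha hp0 b hi,
        seqMul_apply_of_mem_steenrodFil_right ha b hi]
    · rw [seqMul_apply_add_one_of_mem_steenrodFil ha hp0,
        seqMul_apply_add_one_of_mem_steenrodFil_right ha,
        hI.pow_char_pow_eq_one hb (Nat.succ_ne_zero k)]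
      convert I.mul_mem_left (a (k + 1)) hb using 1
      ring
  · refine commSet_subset_steenrodFilHalf (fun a ha b hb i hi => ?_) fun a ha b hb => ?_
    · obtain hi | rfl : i ≤ k ∨ i = k + 1 := by omega
      · rw [seqMul_apply_of_mem_steenrodFil ha.1 hp0 b hi,
          seqMul_apply_of_mem_steenrodFil_right ha.1 b hi]
      · rw [seqMul_apply_add_one_of_mem_steenrodFil ha.1 hp0,
          seqMul_apply_add_one_of_mem_steenrodFil_right ha.1,
          hI.pow_char_pow_eq_one hb (Nat.succ_ne_zero k)]
        linear_combination hI _ ha.2 _ hb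
    · rw [seqMul_apply_add_two_of_mem_steenrodFil ha.1 hp0,
        seqMul_apply_add_two_of_mem_steenrodFil_right ha.1,
        hI.pow_char_pow_eq_one hb (Nat.succ_ne_zero (k + 1)), hI.pow_eq_zero ha.2 hp.two_le]
      have := I.sub_mem (I.mul_mem_left (a (k + 2)) hb)
        (I.mul_mem_left (b 1 ^ p ^ (k + 1)) ha.2)
      convert this using 1
      ring
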